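/- For n ∈ ℕ and ε > 0 define w_ε ∈ H²_loc(ℝ^n) by w_ε(x) := ε|x|². Then there exists ε₀ = ε₀(n) > 0, namely ε₀(n) = 1/√(2^n·(2⁶(4n+3)² − (2n)²)), such that for all ε ∈ (0, ε₀) the function w_ε is not a global minimizer of F. -/

import Mathlib

open MeasureTheory Metric Set Filter Topology
open scoped ENNReal

noncomputable section

/-- `n`-dimensional Euclidean space. -/
abbrev RH (n : ℕ) := EuclideanSpace ℝ (Fin n)

variable {n : ℕ}

/-- Smooth compactly supported test functions with support contained in `Ω`. -/
def IsTestFun (Ω : Set (RH n)) (φ : RH n → ℝ) : Prop :=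
  ContDiff ℝ (⊤ : ℕ∞) φ ∧ HasCompactSupport φ ∧ tsupport φ ⊆ Ω

/-- Classical partial derivative in the `i`-th coordinate direction. -/
def cpderiv (i : Fin n) (φ : RH n → ℝ) : RH n → ℝ :=
  fun x => fderiv ℝ φ x (EuclideanSpace.single i 1)

/-- Classical Laplacian of a (smooth) function. -/
def cLaplacian (φ : RH n → ℝ) : RH n → ℝ :=
  fun x => ∑ i, cpderiv i (cpderiv i φ) x

/-- `g` is the weak `i`-th partial derivative of `u` on `Ω`. -/
def IsWeakPartial (Ω : Set (RH n)) (i : Fin n) (u g : RH n → ℝ) : Prop :=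
  ∀ φ : RH n → ℝ, IsTestFun Ω φ →
    ∫ x in Ω, u x * cpderiv i φ x = - ∫ x in Ω, g x * φ x

/-- `g` is a weak Laplacian of `u` on `Ω`. -/
def IsWeakLaplacian (Ω : Set (RH n)) (u g : RH n → ℝ) : Prop :=
  ∀ φ : RH n → ℝ, IsTestFun Ω φ →
    ∫ x in Ω, u x * cLaplacian φ x = ∫ x in Ω, g x * φ x

/-- `u ∈ H²(Ω)` with weak gradient `g` and weak Hessian `h`. -/
def IsH2With (Ω : Set (RH n)) (u : RH n → ℝ) (g : Fin n → RH n → ℝ)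
    (h : Fin n → Fin n → RH n → ℝ) : Prop :=
  MemLp u 2 (volume.restrict Ω) ∧
  (∀ i, IsWeakPartial Ω i u (g i) ∧ MemLp (g i) 2 (volume.restrict Ω)) ∧
  (∀ i j, IsWeakPartial Ω j (g i) (h i j) ∧ MemLp (h i j) 2 (volume.restrict Ω))

/-- `u ∈ H²(Ω)`. -/
def MemH2 (Ω : Set (RH n)) (u : RH n → ℝ) : Prop :=
  ∃ g h, IsH2With Ω u g h

/-- `u ∈ H₀²(Ω)`: `u ∈ H²(Ω)` and `u` is approximable in the `H²`-norm by
test functions supported in `Ω`. -/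
def MemH20 (Ω : Set (RH n)) (u : RH n → ℝ) : Prop :=
  ∃ g h, IsH2With Ω u g h ∧
    ∃ φ : ℕ → RH n → ℝ, (∀ k, IsTestFun Ω (φ k)) ∧
      Tendsto (fun k => eLpNorm (fun x => u x - φ k x) 2 (volume.restrict Ω)) atTop (𝓝 0) ∧
      (∀ i, Tendsto (fun k => eLpNorm (fun x => g i x - cpderiv i (φ k) x) 2
        (volume.restrict Ω)) atTop (𝓝 0)) ∧
      (∀ i j, Tendsto (fun k => eLpNorm (fun x => h i j x - cpderiv j (cpderiv i (φ k)) x) 2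
        (volume.restrict Ω)) atTop (𝓝 0))

/-- `u ∈ H²_loc(ℝⁿ)`. -/
def MemH2loc (u : RH n → ℝ) : Prop :=
  ∀ Ω : Set (RH n), IsOpen Ω → Bornology.IsBounded Ω → MemH2 Ω u

/-- The two-sided biharmonic Alt–Caffarelli functional
`F(u,Ω) = ∫_Ω (Δu)² dx + |{x ∈ Ω : u x ≠ 0}|`, where the (weak) Laplacian
`Δu = lapu` is given explicitly. -/
def ACF (Ω : Set (RH n)) (lapu u : RH n → ℝ) : ℝ :=
  (∫ x in Ω, (lapu x) ^ 2) + (volume {x ∈ Ω | u x ≠ 0}).toReal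

/-- `u` is a global minimizer of the two-sided biharmonic Alt–Caffarelli functional. -/
def IsGlobalMinimizer (u : RH n → ℝ) : Prop :=
  MemH2loc u ∧
  ∀ Ω : Set (RH n), IsOpen Ω → Bornology.IsBounded Ω →
    ∀ v : RH n → ℝ, MemH2 Ω v → MemH20 Ω (fun x => v x - u x) →
      ∀ lapu lapv : RH n → ℝ, IsWeakLaplacian Ω u lapu → IsWeakLaplacian Ω v lapv →
        ACF Ω lapu u ≤ ACF Ω lapv v

lemma IsTestFun.cpderiv {Ω : Set (RH n)} {φ : RH n → ℝ} (h : IsTestFun Ω φ) (i : Fin n) :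
    IsTestFun Ω (cpderiv i φ) :=
  ⟨(h.1.fderiv_right (m := (⊤ : ℕ∞)) le_rfl).clm_apply contDiff_const, h.2.1.fderiv_apply ℝ _,
    (tsupport_fderiv_apply_subset ℝ _).trans h.2.2⟩

lemma contDiff_cpderiv {u : RH n → ℝ} (hu : ContDiff ℝ (⊤ : ℕ∞) u) (i : Fin n) :
    ContDiff ℝ (⊤ : ℕ∞) (cpderiv i u) :=
  (hu.fderiv_right (m := (⊤ : ℕ∞)) le_rfl).clm_apply contDiff_const

lemma IsTestFun.setIntegral_mul {Ω : Set (RH n)} {φ : RH n → ℝ} (h : IsTestFun Ω φ)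
    (u : RH n → ℝ) : ∫ x in Ω, u x * φ x = ∫ x, u x * φ x := by
  refine setIntegral_eq_integral_of_forall_compl_eq_zero fun x hx => ?_
  rw [image_eq_zero_of_notMem_tsupport fun hx' => hx (h.2.2 hx'), mul_zero]

lemma IsTestFun.integrable_mul {Ω : Set (RH n)} {φ : RH n → ℝ} (h : IsTestFun Ω φ)
    {u : RH n → ℝ} (hu : Continuous u) : Integrable (fun x => u x * φ x) :=
  (hu.mul h.1.continuous).integrable_of_hasCompactSupport h.2.1.mul_left

/-- Classical derivatives of smooth functions are weak derivatives. -/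
lemma isWeakPartial_cpderiv {u : RH n → ℝ} (hu : ContDiff ℝ (⊤ : ℕ∞) u) (Ω : Set (RH n))
    (i : Fin n) : IsWeakPartial Ω i u (cpderiv i u) := by
  intro φ hφ
  rw [(hφ.cpderiv i).setIntegral_mul, hφ.setIntegral_mul]
  exact integral_mul_fderiv_eq_neg_fderiv_mul_of_integrable
    (hφ.integrable_mul (contDiff_cpderiv hu i).continuous)
    ((hφ.cpderiv i).integrable_mul hu.continuous) (hφ.integrable_mul hu.continuous)
    (fun x _ => hu.differentiable (by simp) x) (fun x _ => hφ.1.differentiable (by simp) x)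

/-- The classical Laplacian of a smooth function is a weak Laplacian. -/
lemma isWeakLaplacian_cLaplacian {u : RH n → ℝ} (hu : ContDiff ℝ (⊤ : ℕ∞) u) (Ω : Set (RH n)) :
    IsWeakLaplacian Ω u (cLaplacian u) := by
  intro φ hφ
  have key (i : Fin n) : ∫ x in Ω, u x * cpderiv i (cpderiv i φ) x
      = ∫ x in Ω, cpderiv i (cpderiv i u) x * φ x := by
    rw [isWeakPartial_cpderiv hu Ω i _ (hφ.cpderiv i),
      isWeakPartial_cpderiv (contDiff_cpderiv hu i) Ω i _ hφ, neg_neg]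
  simp only [cLaplacian, Finset.mul_sum, Finset.sum_mul]
  rw [integral_finsetSum _ fun i _ =>
      (((hφ.cpderiv i).cpderiv i).integrable_mul hu.continuous).integrableOn,
    integral_finsetSum _ fun i _ => (hφ.integrable_mul
      (contDiff_cpderiv (contDiff_cpderiv hu i) i).continuous).integrableOn]
  exact Finset.sum_congr rfl fun i _ => key i

lemma memLp_two_restrict_of_continuous {u : RH n → ℝ} (hu : Continuous u) {Ω : Set (RH n)}
    (hΩ : Bornology.IsBounded Ω) : MemLp u 2 (volume.restrict Ω) := by
  have hc : IsCompact (closure Ω) := hΩ.isCompact_closure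
  have : MemLp u 2 (volume.restrict (closure Ω)) := by
    have : IsFiniteMeasure (volume.restrict (closure Ω)) :=
      ⟨by simpa using hc.measure_lt_top⟩
    obtain ⟨C, hC⟩ := hc.exists_bound_of_continuousOn hu.continuousOn
    exact MemLp.of_bound hu.aestronglyMeasurable C
      (ae_restrict_of_forall_mem isClosed_closure.measurableSet hC)
  exact this.mono_measure (Measure.restrict_mono subset_closure le_rfl)

lemma isH2With_of_contDiff {u : RH n → ℝ} (hu : ContDiff ℝ (⊤ : ℕ∞) u) {Ω : Set (RH n)}
    (hΩ : Bornology.IsBounded Ω) :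
    IsH2With Ω u (fun i => cpderiv i u) (fun i j => cpderiv j (cpderiv i u)) :=
  ⟨memLp_two_restrict_of_continuous hu.continuous hΩ,
    fun i => ⟨isWeakPartial_cpderiv hu Ω i,
      memLp_two_restrict_of_continuous (contDiff_cpderiv hu i).continuous hΩ⟩,
    fun i j => ⟨isWeakPartial_cpderiv (contDiff_cpderiv hu i) Ω j,
      memLp_two_restrict_of_continuous (contDiff_cpderiv (contDiff_cpderiv hu i) j).continuous hΩ⟩⟩

lemma IsTestFun.memH20 {φ : RH n → ℝ} {Ω : Set (RH n)} (hφ : IsTestFun Ω φ)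
    (hΩ : Bornology.IsBounded Ω) : MemH20 Ω φ :=
  ⟨_, _, isH2With_of_contDiff hφ.1 hΩ, fun _ => φ, fun _ => hφ, by simp, by simp, by simp⟩

/-- The Laplacian of a radial function written in terms of the squared norm. -/
lemma cLaplacian_comp_norm_sq {f g k : ℝ → ℝ} (hf : ∀ s, HasDerivAt f (g s) s)
    (hg : ∀ s, HasDerivAt g (k s) s) (x : RH n) :
    cLaplacian (fun x : RH n => f (‖x‖ ^ 2)) x
      = 4 * ‖x‖ ^ 2 * k (‖x‖ ^ 2) + 2 * n * g (‖x‖ ^ 2) := by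
  have hd {f g : ℝ → ℝ} (hf : ∀ s, HasDerivAt f (g s) s) (x : RH n) :
      HasFDerivAt (fun x : RH n => f (‖x‖ ^ 2)) (g (‖x‖ ^ 2) • (2 : ℕ) • innerSL ℝ x) x :=
    (hf (‖x‖ ^ 2)).comp_hasFDerivAt x (hasStrictFDerivAt_norm_sq x).hasFDerivAt
  have hp (i : Fin n) : cpderiv i (fun x : RH n => f (‖x‖ ^ 2))
      = fun x => g (‖x‖ ^ 2) * (2 * x i) := by
    funext x
    simp [cpderiv, (hd hf x).fderiv, EuclideanSpace.inner_single_right]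
  have hpp (i : Fin n) : cpderiv i (cpderiv i (fun x : RH n => f (‖x‖ ^ 2))) x
      = 4 * k (‖x‖ ^ 2) * x i ^ 2 + 2 * g (‖x‖ ^ 2) := by
    have hx : HasFDerivAt (fun x : RH n => 2 * x i)
        ((2 : ℝ) • (EuclideanSpace.proj i : RH n →L[ℝ] ℝ)) x :=
      (EuclideanSpace.proj i : RH n →L[ℝ] ℝ).hasFDerivAt.const_smul (2 : ℝ)
    rw [hp, cpderiv, ((hd hg x).fun_mul hx).fderiv]
    simp [EuclideanSpace.inner_single_right]
    ring
  simp only [cLaplacian, hpp, Finset.sum_add_distrib, ← Finset.mul_sum,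
    ← EuclideanSpace.real_norm_sq_eq]
  simp
  ring

/-- A smooth function `f` on the line, with first two derivatives `g` and `k` bounded by `9` on
the unit interval, which vanishes on `(-∞, 1/4]` and is the identity on `[1, ∞)`. -/
lemma exists_smooth_profile : ∃ f g k : ℝ → ℝ, ContDiff ℝ (⊤ : ℕ∞) f ∧
    (∀ s, HasDerivAt f (g s) s) ∧ (∀ s, HasDerivAt g (k s) s) ∧
    (∀ s ≤ 1 / 4, f s = 0) ∧ (∀ s, 1 ≤ s → f s = s ∧ g s = 1 ∧ k s = 0) ∧
    ∀ s, 0 ≤ s → s ≤ 1 → |g s| ≤ 9 ∧ |k s| ≤ 9 := by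
  let B : ContDiffBump (0 : ℝ) := ⟨1 / 8, 3 / 16, by norm_num, by norm_num⟩
  have hB0 (t : ℝ) (ht : 3 / 16 ≤ |t|) : B t = 0 :=
    B.zero_of_le_dist (by simpa [B, Real.dist_eq] using ht)
  set m : ℝ := ∫ t, B t with hm_def
  have hm : 1 / 4 ≤ m := by
    have := B.measure_closedBall_le_integral volume
    rw [Real.volume_real_closedBall (by norm_num [B])] at this
    norm_num [B] at this
    norm_num
    exact this
  have hodd : ∫ t, t * B t = 0 := by
    have := integral_neg_eq_self (fun t : ℝ => t * B t) volume
    simp only [B.neg, neg_mul, integral_neg] at this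
    linarith
  have hBi : Integrable (fun t => B t) := B.integrable
  have htBi : Integrable (fun t => t * B t) :=
    (continuous_id.mul B.continuous).integrable_of_hasCompactSupport B.hasCompactSupport.mul_left
  have hshift (c : ℝ) : ∫ t, B (t - c) = m := integral_sub_right_eq_self (fun t => B t) c
  have hshift' (c : ℝ) : ∫ t, t * B (t - c) = c * m := by
    have := integral_sub_right_eq_self (μ := volume) (fun t : ℝ => t * B t + c * B t) c
    rw [integral_add htBi (hBi.const_mul c), hodd, integral_const_mul, zero_add] at this
    rw [← this]
    exact integral_congr_ae (.of_forall fun t => by simp only; ring)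
  have hcs (c : ℝ) : HasCompactSupport fun t : ℝ => B (t - c) :=
    B.hasCompactSupport.comp_homeomorph (Homeomorph.subRight c)
  have hsm (c : ℝ) : ContDiff ℝ (⊤ : ℕ∞) fun t : ℝ => B (t - c) :=
    B.contDiff.comp (contDiff_id.sub contDiff_const)
  have hi (c : ℝ) : Integrable fun t : ℝ => B (t - c) := hBi.comp_sub_right c
  have hi' (c : ℝ) : Integrable fun t : ℝ => t * B (t - c) :=
    (continuous_id.mul (hsm c).continuous).integrable_of_hasCompactSupport (hcs c).mul_left
  let k : ℝ → ℝ := fun t => 13 / (6 * m) * B (t - 7 / 16) - 7 / (6 * m) * B (t - 13 / 16)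
  have hk : ContDiff ℝ (⊤ : ℕ∞) k :=
    (contDiff_const.mul (hsm _)).sub (contDiff_const.mul (hsm _))
  have hk_left (t : ℝ) (ht : t ≤ 1 / 4) : k t = 0 := by
    simp only [k]
    rw [hB0 _ (by rw [abs_of_neg (by linarith)]; linarith),
      hB0 _ (by rw [abs_of_neg (by linarith)]; linarith)]
    simp
  have hk_right (t : ℝ) (ht : 1 ≤ t) : k t = 0 := by
    simp only [k]
    rw [hB0 _ (by rw [abs_of_pos (by linarith)]; linarith),
      hB0 _ (by rw [abs_of_pos (by linarith)]; linarith)]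
    simp
  have hint : ∫ t, k t = 1 := by
    simp only [k]
    rw [integral_sub ((hi _).const_mul _) ((hi _).const_mul _), integral_const_mul,
      integral_const_mul, hshift, hshift]
    field_simp
    norm_num
  have hint' : ∫ t, t * k t = 0 := by
    have : ∀ t, t * k t = 13 / (6 * m) * (t * B (t - 7 / 16))
        - 7 / (6 * m) * (t * B (t - 13 / 16)) := fun t => by simp only [k]; ring
    simp only [this]
    rw [integral_sub ((hi' _).const_mul _) ((hi' _).const_mul _), integral_const_mul,
      integral_const_mul, hshift', hshift']
    ring
  have hk_bd (t : ℝ) : |k t| ≤ 9 := by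
    have ha : 13 / (6 * m) ≤ 9 := by rw [div_le_iff₀ (by linarith)]; linarith
    have hb : 7 / (6 * m) ≤ 9 := by rw [div_le_iff₀ (by linarith)]; linarith
    have ha0 : 0 ≤ 13 / (6 * m) := div_nonneg (by norm_num) (by linarith)
    have hb0 : 0 ≤ 7 / (6 * m) := div_nonneg (by norm_num) (by linarith)
    have h1 := mul_le_mul ha (B.le_one (x := t - 7 / 16)) B.nonneg (by norm_num)
    have h2 := mul_le_mul hb (B.le_one (x := t - 13 / 16)) B.nonneg (by norm_num)
    have h3 := mul_nonneg ha0 (B.nonneg (x := t - 7 / 16))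
    have h4 := mul_nonneg hb0 (B.nonneg (x := t - 13 / 16))
    simp only [k]
    rw [abs_le]
    constructor <;> linarith
  have hsub (h : ℝ → ℝ) (s : ℝ) (hs : 1 ≤ s) :
      ∫ t in (0 : ℝ)..s, h t * k t = ∫ t, h t * k t := by
    refine intervalIntegral.integral_eq_integral_of_support_subset fun t ht => ?_
    have hkt : k t ≠ 0 := right_ne_zero_of_mul ht
    constructor
    · by_contra! h0
      exact hkt (hk_left t (by linarith))
    · by_contra! h0
      exact hkt (hk_right t (by linarith))
  have hzero (h : ℝ → ℝ) (s : ℝ) (hs : s ≤ 1 / 4) : ∫ t in (0 : ℝ)..s, h t * k t = 0 := by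
    rw [intervalIntegral.integral_congr (g := fun _ => (0 : ℝ)), intervalIntegral.integral_zero]
    intro t ht
    have : t ≤ 1 / 4 := ht.2.trans (max_le (by norm_num) hs)
    simp [hk_left t this]
  let g : ℝ → ℝ := fun s => ∫ t in (0 : ℝ)..s, 1 * k t
  let h : ℝ → ℝ := fun s => ∫ t in (0 : ℝ)..s, t * k t
  let f : ℝ → ℝ := fun s => s * g s - h s
  have hkc := hk.continuous
  have hg (s : ℝ) : HasDerivAt g (k s) s := by
    simpa [g] using (hkc.integral_hasStrictDerivAt 0 s).hasDerivAt
  have hh (s : ℝ) : HasDerivAt h (s * k s) s :=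
    ((continuous_id.mul hkc).integral_hasStrictDerivAt 0 s).hasDerivAt
  have hf (s : ℝ) : HasDerivAt f (g s) s := by
    exact (((hasDerivAt_id s).mul (hg s)).sub (hh s)).congr_deriv (by simp)
  have hgs : ContDiff ℝ (⊤ : ℕ∞) g :=
    contDiff_infty_iff_deriv.2 ⟨fun s => (hg s).differentiableAt, by
      rwa [show deriv g = k from funext fun s => (hg s).deriv]⟩
  refine ⟨f, g, k, contDiff_infty_iff_deriv.2 ⟨fun s => (hf s).differentiableAt, by
      rwa [show deriv f = g from funext fun s => (hf s).deriv]⟩, hf, hg, fun s hs => ?_,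
    fun s hs => ?_, fun s hs0 hs1 => ⟨?_, hk_bd s⟩⟩
  · simp only [f, g, h]
    rw [hzero (fun _ => 1) s hs, hzero (fun t => t) s hs]
    simp
  · have hg1 : g s = 1 := by
      simp only [g]
      rw [hsub (fun _ => 1) s hs]
      simpa using hint
    have hh0 : h s = 0 := (hsub (fun t => t) s hs).trans hint'
    exact ⟨by simp [f, hg1, hh0], hg1, hk_right s hs⟩
  · have := intervalIntegral.norm_integral_le_of_norm_le_const (a := 0) (b := s)
      (f := fun t => 1 * k t) (C := 9) fun t _ => by simpa using hk_bd t
    rw [sub_zero, abs_of_nonneg hs0, Real.norm_eq_abs] at this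
    exact this.trans (by linarith)

/-- for `ε₀(n) = 1/√(2ⁿ(2⁶(4n+3)² - (2n)²))` and every
`ε ∈ (0, ε₀)`, the function `w_ε(x) = ε|x|²` is not a global minimizer of `F`. -/
theorem statement12 (n : ℕ) (hn : 0 < n) :
    0 < 1 / Real.sqrt ((2 : ℝ) ^ n * (2 ^ 6 * (4 * (n : ℝ) + 3) ^ 2 - (2 * (n : ℝ)) ^ 2)) ∧
    ∀ ε : ℝ, 0 < ε →
      ε < 1 / Real.sqrt ((2 : ℝ) ^ n * (2 ^ 6 * (4 * (n : ℝ) + 3) ^ 2 - (2 * (n : ℝ)) ^ 2)) →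
      ¬ IsGlobalMinimizer (fun x : RH n => ε * ‖x‖ ^ 2) := by
  have hn1 : (1 : ℝ) ≤ n := by exact_mod_cast hn
  have hC : 0 < (2 : ℝ) ^ 6 * (4 * (n : ℝ) + 3) ^ 2 - (2 * (n : ℝ)) ^ 2 := by nlinarith
  set C : ℝ := 2 ^ 6 * (4 * (n : ℝ) + 3) ^ 2 - (2 * (n : ℝ)) ^ 2 with hC_def
  have hP : 0 < (2 : ℝ) ^ n * C := by positivity
  refine ⟨by positivity, fun ε hε hεlt hmin => ?_⟩
  have hsmall : ε ^ 2 * C < (1 / 2) ^ n := by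
    rw [lt_div_iff₀ (Real.sqrt_pos.2 hP)] at hεlt
    have h1 : (ε * √(2 ^ n * C)) ^ 2 < 1 := by
      have : 0 ≤ ε * √(2 ^ n * C) := by positivity
      nlinarith
    rw [mul_pow, Real.sq_sqrt hP.le] at h1
    rw [one_div, inv_pow, ← one_div, lt_div_iff₀ (by positivity)]
    linarith
  obtain ⟨f, g, k, hfs, hf, hg, hf0, hf1, hbd⟩ := exists_smooth_profile
  have hns : ContDiff ℝ (⊤ : ℕ∞) fun x : RH n => ‖x‖ ^ 2 := contDiff_norm_sq ℝ
  let w : RH n → ℝ := fun x => ε * ‖x‖ ^ 2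
  let v : RH n → ℝ := fun x => ε * f (‖x‖ ^ 2)
  have hw : ContDiff ℝ (⊤ : ℕ∞) w := contDiff_const.mul hns
  have hv : ContDiff ℝ (⊤ : ℕ∞) v := contDiff_const.mul (hfs.comp hns)
  have hlw (x : RH n) : cLaplacian w x = 2 * n * ε := by
    have := cLaplacian_comp_norm_sq (f := fun s => ε * s) (g := fun _ => ε) (k := fun _ => 0)
      (fun s => by simpa using (hasDerivAt_id s).const_mul ε) (fun s => hasDerivAt_const s ε) x
    simpa using this
  have hlv (x : RH n) : cLaplacian v x
      = ε * (4 * ‖x‖ ^ 2 * k (‖x‖ ^ 2) + 2 * n * g (‖x‖ ^ 2)) := by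
    rw [cLaplacian_comp_norm_sq (f := fun s => ε * f s) (fun s => (hf s).const_mul ε)
      (fun s => (hg s).const_mul ε) x]
    ring
  have hbound (x : RH n) : cLaplacian v x ^ 2
      ≤ (2 * n * ε) ^ 2 + (ball (0 : RH n) 1).indicator (fun _ => ε ^ 2 * C) x := by
    rw [hlv]
    by_cases hx : x ∈ ball (0 : RH n) 1
    · have hx1 : ‖x‖ ^ 2 ≤ 1 := by
        have : ‖x‖ < 1 := by simpa using hx
        nlinarith [norm_nonneg x]
      obtain ⟨hgb, hkb⟩ := hbd _ (sq_nonneg ‖x‖) hx1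
      have hlap : |4 * ‖x‖ ^ 2 * k (‖x‖ ^ 2) + 2 * n * g (‖x‖ ^ 2)|
          ≤ 8 * (4 * (n : ℝ) + 3) := by
        refine (abs_add_le _ _).trans ?_
        rw [abs_mul _ (k _), abs_mul _ (g _), abs_of_nonneg (by positivity : 0 ≤ 4 * ‖x‖ ^ 2),
          abs_of_nonneg (by positivity : 0 ≤ 2 * (n : ℝ))]
        have h1 := mul_le_mul hx1 hkb (abs_nonneg _) (by norm_num)
        have h2 := mul_le_mul_of_nonneg_left hgb (by positivity : 0 ≤ 2 * (n : ℝ))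
        linarith
      rw [indicator_of_mem hx, mul_pow, hC_def]
      have := mul_le_mul_of_nonneg_left (sq_le_sq' (neg_le_of_abs_le hlap) (le_of_abs_le hlap))
        (sq_nonneg ε)
      linarith
    · have hx1 : 1 ≤ ‖x‖ ^ 2 := by
        have : 1 ≤ ‖x‖ := by simpa using hx
        nlinarith
      obtain ⟨-, hg1, hk1⟩ := hf1 _ hx1
      rw [indicator_of_notMem hx, hg1, hk1]
      apply le_of_eq
      ring
  let Ω : Set (RH n) := ball 0 2
  have hΩb : Bornology.IsBounded Ω := isBounded_ball
  have htest : IsTestFun Ω fun x => v x - w x := by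
    have hts : tsupport (fun x => v x - w x) ⊆ closedBall 0 1 := by
      refine closure_minimal (fun x hx => ?_) isClosed_closedBall
      by_contra hx'
      have hx1 : 1 ≤ ‖x‖ ^ 2 := by
        have : 1 < ‖x‖ := by simpa using hx'
        nlinarith
      exact hx (by simp [v, w, (hf1 _ hx1).1])
    exact ⟨hv.sub hw, (isCompact_closedBall _ _).of_isClosed_subset (isClosed_tsupport _) hts,
      hts.trans (closedBall_subset_ball (by norm_num))⟩
  have hle := hmin.2 Ω isOpen_ball hΩb v ⟨_, _, isH2With_of_contDiff hv hΩb⟩ (htest.memH20 hΩb)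
    (cLaplacian w) (cLaplacian v) (isWeakLaplacian_cLaplacian hw Ω)
    (isWeakLaplacian_cLaplacian hv Ω)
  have : Nonempty (Fin n) := ⟨⟨0, hn⟩⟩
  have : Nontrivial (RH n) := inferInstance
  have hvw : volume.real {x ∈ Ω | w x ≠ 0} = volume.real Ω := by
    have : {x ∈ Ω | w x ≠ 0} = Ω \ {0} := by
      ext x
      simp [w, hε.ne']
    rw [this]
    exact measureReal_congr (sdiff_null_ae_eq_self (measure_singleton 0))
  have hvv : volume.real {x ∈ Ω | v x ≠ 0}
      ≤ volume.real Ω - (1 / 2) ^ n * volume.real (ball (0 : RH n) 1) := by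
    have hsub : {x ∈ Ω | v x ≠ 0} ⊆ Ω \ ball 0 (1 / 2) := by
      refine fun x hx => ⟨hx.1, fun hx' => hx.2 ?_⟩
      have : ‖x‖ < 1 / 2 := by simpa using hx'
      simp [v, hf0 (‖x‖ ^ 2) (by nlinarith [norm_nonneg x])]
    have hhalf : volume.real (ball (0 : RH n) (1 / 2))
        = (1 / 2) ^ n * volume.real (ball (0 : RH n) 1) := by
      rw [measureReal_def, Measure.addHaar_ball _ _ (by norm_num), ENNReal.toReal_mul,
        ENNReal.toReal_ofReal (by positivity), finrank_euclideanSpace_fin, measureReal_def]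
    refine (measureReal_mono hsub
      (measure_ne_top_of_subset sdiff_subset measure_ball_lt_top.ne)).trans ?_
    rw [measureReal_sdiff (ball_subset_ball (by norm_num)) measurableSet_ball, hhalf]
  have hlwi : ∫ x in Ω, cLaplacian w x ^ 2 = volume.real Ω * (2 * n * ε) ^ 2 := by
    simp [hlw]
  have hlvi : ∫ x in Ω, cLaplacian v x ^ 2
      ≤ volume.real Ω * (2 * n * ε) ^ 2 + volume.real (ball (0 : RH n) 1) * (ε ^ 2 * C) := by
    have hfin : IsFiniteMeasure (volume.restrict Ω) :=
      ⟨by simpa [Ω] using measure_ball_lt_top⟩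
    have hci : Integrable (fun x => cLaplacian v x ^ 2) (volume.restrict Ω) := by
      have hcont : Continuous (cLaplacian v) := continuous_finsetSum _ fun i _ =>
        (contDiff_cpderiv (contDiff_cpderiv hv i) i).continuous
      exact (memLp_two_restrict_of_continuous hcont hΩb).integrable_sq
    have hii : Integrable ((ball (0 : RH n) 1).indicator fun _ => ε ^ 2 * C)
        (volume.restrict Ω) := (integrable_const _).indicator measurableSet_ball
    refine (integral_mono hci ((integrable_const _).add hii) hbound).trans_eq ?_
    rw [integral_add' (integrable_const _) hii, integral_indicator measurableSet_ball,
      Measure.restrict_restrict measurableSet_ball,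
      inter_eq_self_of_subset_left (ball_subset_ball (by norm_num))]
    simp
  have hpos : 0 < volume.real (ball (0 : RH n) 1) :=
    ENNReal.toReal_pos (measure_ball_pos _ _ one_pos).ne' measure_ball_lt_top.ne
  have := mul_lt_mul_of_pos_right hsmall hpos
  simp only [ACF, ← measureReal_def] at hle
  change (∫ x in Ω, cLaplacian w x ^ 2) + volume.real {x ∈ Ω | w x ≠ 0} ≤ _ at hle
  rw [hvw, hlwi] at hle
  linarith

end
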